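/- For each (x,t) ∈ εℤ² with t > 0: a₁(x,t,m,ε) = a₁(−x,t,m,ε), (t−x)·a₂(x,t,m,ε) = (t+x−2ε)·a₂(2ε−x,t,m,ε), and a₁(x,t,m,ε) + mε·a₂(x,t,m,ε) = a₁(2ε−x,t,m,ε) + mε·a₂(2ε−x,t,m,ε). -/

import Mathlib

open scoped BigOperators

/-- The final x-coordinate of a checker path from `(0,0)` encoded by its sequence of moves
(`true` = move `(1,1)`, `false` = move `(-1,1)`). -/
def moveEndpoint {n : ℕ} (d : Fin n → Bool) : ℤ :=
  ∑ k, (if d k then (1 : ℤ) else -1)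

/-- The number of turns of a checker path encoded by its sequence of moves. -/
def nturns {n : ℕ} (d : Fin n → Bool) : ℕ :=
  ((List.ofFn d).zip (List.ofFn d).tail).countP fun p => p.1 != p.2

/-- Checker paths from `(0,0)` to `(x,t)` whose first step is to `(1,1)`,
encoded by their sequences of moves. -/
def cpaths (x t : ℤ) : Finset (Fin t.toNat → Bool) :=
  Finset.univ.filter fun d => moveEndpoint d = x ∧ (List.ofFn d).headI = true

/-- Feynman checkers amplitude with mass: `a(x·ε, t·ε, m, ε)` written in lattice
coordinates, i.e. `am m ε x t = (1+m²ε²)^((1-t)/2) * i * ∑ₛ (-i·m·ε)^turns(s)`. -/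
noncomputable def am (m ε : ℝ) (x t : ℤ) : ℂ :=
  (Real.sqrt (1 + m ^ 2 * ε ^ 2) : ℂ) ^ (1 - t) * Complex.I *
    ∑ d ∈ cpaths x t, (-Complex.I * (m * ε)) ^ nturns d

/-- Sum over paths with first move `b` and `n` further moves. -/
noncomputable def headSum (z : ℂ) (n : ℕ) (b : Bool) (x : ℤ) : ℂ :=
  ∑ d : Fin n → Bool, if moveEndpoint (Fin.cons b d : Fin (n + 1) → Bool) = x then
    z ^ nturns (Fin.cons b d : Fin (n + 1) → Bool) else 0

lemma moveEndpoint_cons {n : ℕ} (b : Bool) (d : Fin n → Bool) :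
    moveEndpoint (Fin.cons b d : Fin (n + 1) → Bool) = (if b then 1 else -1) + moveEndpoint d := by
  simp [moveEndpoint, Fin.sum_univ_succ]

lemma nturns_cons {n : ℕ} (b c : Bool) (d : Fin n → Bool) :
    nturns (Fin.cons b (Fin.cons c d : Fin (n + 1) → Bool) : Fin (n + 2) → Bool) =
      nturns (Fin.cons c d : Fin (n + 1) → Bool) + (if b = c then 0 else 1) := by
  unfold nturns
  rw [List.ofFn_succ (n := n + 1), List.ofFn_succ (n := n)]
  simp only [Fin.cons_zero, Fin.cons_succ, List.tail_cons, List.zip_cons_cons, List.countP_cons]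
  cases b <;> cases c <;> simp

lemma sum_cons {n : ℕ} (f : (Fin (n + 1) → Bool) → ℂ) :
    ∑ d, f d = ∑ b : Bool, ∑ d : Fin n → Bool, f (Fin.cons b d) := by
  rw [← Fintype.sum_prod_type']
  exact (Fintype.sum_equiv (Fin.consEquiv (fun _ => Bool)) _ _ (fun _ => rfl)).symm

lemma headSum_succ (z : ℂ) (n : ℕ) (b : Bool) (x : ℤ) :
    headSum z (n + 1) b x = headSum z n b (x - (if b then 1 else -1)) +
      z * headSum z n (!b) (x - (if b then 1 else -1)) := by
  have key : ∀ c : Bool, (∑ d : Fin n → Bool,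
      if moveEndpoint (Fin.cons b (Fin.cons c d : Fin (n + 1) → Bool) : Fin (n + 2) → Bool) = x then
      z ^ nturns (Fin.cons b (Fin.cons c d : Fin (n + 1) → Bool) : Fin (n + 2) → Bool) else 0) =
      (if b = c then 1 else z) * headSum z n c (x - (if b then 1 else -1)) := by
    intro c
    unfold headSum
    rw [Finset.mul_sum]
    refine Finset.sum_congr rfl fun d _ => ?_
    rw [moveEndpoint_cons b, nturns_cons]
    by_cases h : moveEndpoint (Fin.cons c d : Fin (n + 1) → Bool) = x - (if b then 1 else -1)
    · rw [if_pos h, if_pos (by rw [h]; ring)]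
      by_cases hb : b = c
      · simp [hb]
      · simp [hb, pow_succ, mul_comm]
    · rw [if_neg h, if_neg (fun h' => h (by rw [← h']; ring)), mul_zero]
  conv_lhs => unfold headSum
  rw [sum_cons, Fintype.sum_bool, key, key]
  cases b <;> simp [add_comm]

lemma headSum_zero (z : ℂ) (b : Bool) (x : ℤ) :
    headSum z 0 b x = if (if b then 1 else -1) = x then 1 else 0 := by
  simp [headSum, moveEndpoint, nturns]

lemma headSum_flip (z : ℂ) (n : ℕ) : ∀ (b : Bool) (x : ℤ),
    headSum z n (!b) x = headSum z n b (-x) := by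
  induction n with
  | zero =>
    intro b x
    rw [headSum_zero, headSum_zero]
    cases b <;> simp only [Bool.not_true, Bool.not_false, if_true, if_false, Bool.false_eq_true] <;>
      congr 1 <;> apply propext <;> omega
  | succ n ih =>
    intro b x
    rw [headSum_succ, headSum_succ, ih, ih]
    cases b <;> simp [sub_eq_add_neg, add_comm]

lemma cpaths_sum (z : ℂ) (x : ℤ) (n : ℕ) :
    ∑ d ∈ cpaths x ((n + 1 : ℕ) : ℤ), z ^ nturns d = headSum z n true x := by
  have : ∀ (k : ℕ), k = n + 1 → ∑ d ∈ (Finset.univ.filter fun d : Fin k → Bool =>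
      moveEndpoint d = x ∧ (List.ofFn d).headI = true), z ^ nturns d = headSum z n true x := by
    rintro k rfl
    rw [Finset.sum_filter, sum_cons, Fintype.sum_bool]
    simp [headSum, List.ofFn_succ]
  exact this _ (by simp)

/-- Unnormalised amplitude. -/
noncomputable def amp (μ : ℝ) (n : ℕ) (x : ℤ) : ℂ :=
  Complex.I * headSum (-Complex.I * μ) n true x

lemma amp_succ (μ : ℝ) (n : ℕ) (x : ℤ) :
    amp μ (n + 1) x = amp μ n (x - 1) + (-Complex.I * μ) * amp μ n (1 - x) := by
  unfold amp
  rw [headSum_succ, headSum_flip]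
  simp
  ring

lemma amp_succ_re (μ : ℝ) (n : ℕ) (x : ℤ) :
    (amp μ (n + 1) x).re = (amp μ n (x - 1)).re + μ * (amp μ n (1 - x)).im := by
  rw [amp_succ]; simp

lemma amp_succ_im (μ : ℝ) (n : ℕ) (x : ℤ) :
    (amp μ (n + 1) x).im = (amp μ n (x - 1)).im - μ * (amp μ n (1 - x)).re := by
  rw [amp_succ]; simp; ring

lemma amp_zero (μ : ℝ) (x : ℤ) : amp μ 0 x = if 1 = x then Complex.I else 0 := by
  simp [amp, headSum_zero]

lemma amp_symm (μ : ℝ) (n : ℕ) :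
    (∀ x : ℤ, (amp μ n x).re = (amp μ n (-x)).re) ∧
    (∀ x : ℤ, ((n : ℝ) + 1 - x) * (amp μ n x).im = (n + 1 + x - 2) * (amp μ n (2 - x)).im) ∧
    (∀ x : ℤ, (amp μ n x).re + μ * (amp μ n x).im =
      (amp μ n (2 - x)).re + μ * (amp μ n (2 - x)).im) ∧
    (∀ x : ℤ, ((n : ℝ) + 1 - x) * (amp μ n x).im - (n + 1 + x) * (amp μ n (-x)).im =
      -2 * μ * x * (amp μ n x).re) := by
  induction n with
  | zero =>
    have hre : ∀ x, (amp μ 0 x).re = 0 := by intro x; rw [amp_zero]; split_ifs <;> simp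
    have him : ∀ x, (amp μ 0 x).im = if 1 = x then 1 else 0 := by
      intro x; rw [amp_zero]; split_ifs <;> simp
    simp only [hre, him]
    refine ⟨fun x => trivial, fun x => ?_, fun x => ?_, fun x => ?_⟩
    · by_cases h : x = 1
      · subst h; norm_num
      · rw [if_neg (by omega), if_neg (by omega)]; simp
    · by_cases h : x = 1
      · subst h; norm_num
      · rw [if_neg (by omega), if_neg (by omega)]
    · by_cases h : x = 1
      · subst h; norm_num
      · by_cases h' : x = -1
        · subst h'; norm_num
        · rw [if_neg (by omega), if_neg (by omega)]; simp
  | succ n ih =>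
    obtain ⟨h1, h2, h3, h4⟩ := ih
    have hL : ∀ x : ℤ, (amp μ (n + 1) x).re =
        (amp μ n (x + 1)).re + μ * (amp μ n (x + 1)).im := by
      intro x
      rw [amp_succ_re, h1, h3 (x + 1)]
      ring_nf
    have hR : ∀ x : ℤ, (amp μ (n + 1) x).im =
        (amp μ n (x - 1)).im - μ * (amp μ n (x - 1)).re := by
      intro x
      rw [amp_succ_im, h1 (x - 1)]
      ring_nf
    simp only [hL, hR]
    refine ⟨fun x => ?_, fun x => ?_, fun x => ?_, fun y => ?_⟩
    · rw [h3]
      ring_nf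
    · have a := h4 (x - 1)
      have b := h1 (x - 1)
      rw [show -(x - 1) = 1 - x by ring] at a b
      rw [show 2 - x - 1 = 1 - x by ring]
      rw [← b]
      push_cast at a ⊢
      linear_combination a
    · have a := h3 (x + 1)
      have b := h3 (x - 1)
      have c := h1 (x - 1)
      rw [show 2 - (x + 1) = 1 - x by ring] at a
      rw [show 2 - (x - 1) = 3 - x by ring] at b
      rw [show -(x - 1) = 1 - x by ring] at c
      rw [show 2 - x - 1 = 1 - x by ring, show 2 - x + 1 = 3 - x by ring]
      linear_combination a + b - (1 + μ ^ 2) * c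
    · have a := h4 (y - 1)
      have b := h4 (y + 1)
      have c := h2 (y + 1)
      have d := h3 (y + 1)
      have e := h1 (y - 1)
      have f := h1 (y + 1)
      rw [show -(y - 1) = 1 - y by ring] at a e
      rw [show -(y + 1) = -y - 1 by ring] at b f
      rw [show 2 - (y + 1) = 1 - y by ring] at c d
      rw [← e] at d
      rw [← f]
      push_cast at a b c ⊢
      linear_combination a + b - c + μ * ((n : ℝ) + 1 + y - 1) * d - μ ^ 2 * c

lemma am_eq (m ε : ℝ) (x : ℤ) (n : ℕ) :
    am m ε x ((n + 1 : ℕ) : ℤ) =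
      ((Real.sqrt (1 + m ^ 2 * ε ^ 2) ^ (1 - ((n + 1 : ℕ) : ℤ)) : ℝ) : ℂ) * amp (m * ε) n x := by
  unfold am amp
  rw [cpaths_sum]
  push_cast
  ring

/-- Symmetry for the model with mass, in lattice coordinates `(x,t) ↦ (xε, tε)`. -/
theorem symmetry_mass (m ε : ℝ) (hε : 0 < ε) (hm : 0 ≤ m) (x t : ℤ) (ht : 0 < t) :
    (am m ε x t).re = (am m ε (-x) t).re ∧
    ((t : ℝ) * ε - x * ε) * (am m ε x t).im =
      ((t : ℝ) * ε + x * ε - 2 * ε) * (am m ε (2 - x) t).im ∧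
    (am m ε x t).re + m * ε * (am m ε x t).im =
      (am m ε (2 - x) t).re + m * ε * (am m ε (2 - x) t).im := by
  obtain ⟨n, rfl⟩ : ∃ n : ℕ, t = ((n + 1 : ℕ) : ℤ) := ⟨(t - 1).toNat, by push_cast; omega⟩
  obtain ⟨h1, h2, h3, -⟩ := amp_symm (m * ε) n
  simp only [am_eq, Complex.re_ofReal_mul, Complex.im_ofReal_mul]
  generalize Real.sqrt (1 + m ^ 2 * ε ^ 2) ^ (1 - ((n + 1 : ℕ) : ℤ)) = N
  refine ⟨by rw [h1], ?_, ?_⟩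
  · have a := h2 x
    push_cast
    linear_combination N * ε * a
  · linear_combination N * h3 x
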